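/- Let b ∈ (0, 1). There exists a constant C_b > 0 such that for every t > 0 and every x ≠ 0 with t^{1/3}|x| < (t^{1/3} x²)^{−1} (equivalently |x|³ t^{2/3} < 1), one has ( ∫_{{w : t^{1/3}|x| < |w| < (t^{1/3}x²)^{−1}}} |e^{i(−3x²t^{2/3}w + 3x t^{1/3} w² − w³)} − 1|² / |w|^{1+2b} dw )^{1/2} ≤ C_b. -/

import Mathlib

open MeasureTheory

/-- The phase `−3x²t^{2/3}w + 3xt^{1/3}w² − w³` arising from the change of variables
`w = t^{1/3}(x − y)` in the Stein derivative of `y ↦ e^{ity³}`. -/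
noncomputable def cubicPhase (t x w : ℝ) : ℝ :=
  -3 * x ^ 2 * t ^ ((2 : ℝ) / 3) * w + 3 * x * t ^ ((1 : ℝ) / 3) * w ^ 2 - w ^ 3

/-- Where `|w|` dominates `t^{1/3}|x|`, the cubic phase is controlled by its cubic term. -/
theorem abs_cubicPhase_le {t x w : ℝ} (ht : 0 ≤ t) (hw : t ^ ((1 : ℝ) / 3) * |x| ≤ |w|) :
    |cubicPhase t x w| ≤ 7 * |w| ^ 3 := by
  have hsq : t ^ ((2 : ℝ) / 3) = (t ^ ((1 : ℝ) / 3)) ^ 2 := by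
    rw [← Real.rpow_natCast, ← Real.rpow_mul ht]
    norm_num
  have hs : 0 ≤ t ^ ((1 : ℝ) / 3) := Real.rpow_nonneg ht _
  rw [cubicPhase, hsq]
  generalize t ^ ((1 : ℝ) / 3) = s at hs hw
  have h₀ : 0 ≤ s * |x| := by positivity
  calc |-3 * x ^ 2 * s ^ 2 * w + 3 * x * s * w ^ 2 - w ^ 3|
      ≤ |-3 * x ^ 2 * s ^ 2 * w| + |3 * x * s * w ^ 2| + |w ^ 3| :=
        (abs_sub _ _).trans (by gcongr; exact abs_add_le _ _)
    _ = 3 * (s * |x|) ^ 2 * |w| + 3 * (s * |x|) * |w| ^ 2 + |w| ^ 3 := by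
        simp only [abs_mul, abs_pow, abs_neg, abs_of_nonneg hs, Nat.abs_ofNat]
        ring
    _ ≤ 3 * |w| ^ 2 * |w| + 3 * |w| * |w| ^ 2 + |w| ^ 3 := by gcongr
    _ = 7 * |w| ^ 3 := by ring

/-- If `|θ| ≤ 7r³`, then `|e^{iθ} - 1|² / r^p` is dominated by a multiple of `(1 + r)^{-p}`. -/
theorem norm_exp_sub_one_sq_div_rpow_le {p θ r : ℝ} (hp : 0 ≤ p) (hp' : p ≤ 6) (hr : 0 ≤ r)
    (hθ : |θ| ≤ 7 * r ^ 3) :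
    ‖Complex.exp (Complex.I * (θ : ℂ)) - 1‖ ^ 2 / r ^ p ≤
      49 * 2 ^ p * (1 + r) ^ (-p) := by
  have hexp : ‖Complex.exp (Complex.I * (θ : ℂ)) - 1‖ ≤ |θ| := by
    simpa using Real.norm_exp_I_mul_ofReal_sub_one_le (x := θ)
  have hexp' : ‖Complex.exp (Complex.I * (θ : ℂ)) - 1‖ ≤ 2 := by
    rw [Complex.norm_exp_I_mul_ofReal_sub_one, norm_mul, Real.norm_eq_abs, Real.norm_eq_abs]
    have := Real.abs_sin_le_one (θ / 2)
    norm_num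
    linarith
  have ha := norm_nonneg (Complex.exp (Complex.I * (θ : ℂ)) - 1)
  generalize ‖Complex.exp (Complex.I * (θ : ℂ)) - 1‖ = a at *
  rcases hr.eq_or_lt with rfl | hr
  · have : a ^ 2 ≤ 0 := by nlinarith [abs_nonneg θ]
    calc a ^ 2 / (0 : ℝ) ^ p ≤ 0 := div_nonpos_of_nonpos_of_nonneg this (by positivity)
      _ ≤ _ := by positivity
  rw [Real.rpow_neg (by positivity), ← div_eq_mul_inv, div_le_div_iff₀ (by positivity)
    (by positivity), mul_assoc, ← Real.mul_rpow (by norm_num) hr.le]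
  rcases le_total r 1 with h | h
  · have h₁ : a ^ 2 ≤ 49 * r ^ p := calc
      a ^ 2 ≤ (7 * r ^ 3) ^ 2 := by gcongr; exact hexp.trans hθ
      _ = 49 * r ^ (6 : ℝ) := by norm_cast; ring
      _ ≤ 49 * r ^ p := by
        gcongr 49 * ?_
        exact Real.rpow_le_rpow_of_exponent_ge hr h hp'
    calc a ^ 2 * (1 + r) ^ p ≤ 49 * r ^ p * 2 ^ p := by gcongr; linarith
      _ = 49 * (2 * r) ^ p := by rw [Real.mul_rpow (by norm_num) hr.le]; ring
  · have h₁ : a ^ 2 ≤ 49 := by nlinarith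
    gcongr
    linarith

theorem cubic_phase_integral_middle (b : ℝ) (hb : b ∈ Set.Ioo (0 : ℝ) 1) :
    ∃ C : ℝ, 0 < C ∧ ∀ t : ℝ, 0 < t → ∀ x : ℝ, x ≠ 0 →
      t ^ ((1 : ℝ) / 3) * |x| < (t ^ ((1 : ℝ) / 3) * x ^ 2)⁻¹ →
      (∫ w in {w : ℝ | t ^ ((1 : ℝ) / 3) * |x| < |w| ∧ |w| < (t ^ ((1 : ℝ) / 3) * x ^ 2)⁻¹},
          ‖Complex.exp (Complex.I * ((cubicPhase t x w : ℝ) : ℂ)) - 1‖ ^ 2 /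
            |w| ^ (1 + 2 * b)) ^ ((1 : ℝ) / 2) ≤ C := by
  obtain ⟨hb₀, hb₁⟩ := hb
  let g : ℝ → ℝ := fun w ↦ 49 * 2 ^ (1 + 2 * b) * (1 + |w|) ^ (-(1 + 2 * b))
  have hg : Integrable g :=
    (integrable_one_add_norm (E := ℝ) (μ := volume) (by simp [hb₀])).const_mul _
  have hg₀ (w : ℝ) : 0 ≤ g w := by positivity
  refine ⟨(∫ w, g w) ^ ((1 : ℝ) / 2) + 1, ?_, fun t ht x _ _ ↦ ?_⟩
  · have : 0 ≤ ∫ w, g w := integral_nonneg hg₀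
    positivity
  refine le_add_of_le_of_nonneg (Real.rpow_le_rpow (integral_nonneg fun w ↦ by positivity) ?_
    (by norm_num)) zero_le_one
  have hS : MeasurableSet
      {w : ℝ | t ^ ((1 : ℝ) / 3) * |x| < |w| ∧ |w| < (t ^ ((1 : ℝ) / 3) * x ^ 2)⁻¹} :=
    (measurableSet_lt measurable_const measurable_norm).inter
      (measurableSet_lt measurable_norm measurable_const)
  refine (integral_mono_of_nonneg (.of_forall fun w ↦ by positivity) hg.integrableOn ?_).trans
    (setIntegral_le_integral hg (.of_forall hg₀))
  filter_upwards [ae_restrict_mem hS] with w hw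
  exact norm_exp_sub_one_sq_div_rpow_le (by linarith) (by linarith) (abs_nonneg w)
    (abs_cubicPhase_le ht.le hw.1.le)
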